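/- arXiv:2502.03163 — 4 statements merged into one kernel-verified Lean document; each statement's English description precedes it below -/
import Mathlib

section
/- For every word w ∈ 𝒲_m, the iterated differential operator V_w : C^∞(ℝ^N) → C^∞(ℝ^N) admits the tree expansion V_w = Σ_{τ^0 ∈ 𝕋_w^0} V_{τ^0}, i.e. V_w equals the sum of the tree-like operators over all letter-labelled recursive trees of order m+1 whose root is labelled 0 and whose remaining vertices are labelled by the letters of w (Lemma 3.4). -/
/-- The first-order differential operator associated with a vector field `V i`:
`(V_i φ)(x) = (∇φ(x))ᵀ V_i(x) = dφ_x[V_i(x)]`. -/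
noncomputable def vfOp {N d : ℕ} (V : Fin d → (Fin N → ℝ) → (Fin N → ℝ)) (i : Fin d)
    (φ : (Fin N → ℝ) → ℝ) : (Fin N → ℝ) → ℝ :=
  fun x => fderiv ℝ φ x (V i x)

/-- The iterated operator `V_w`, defined by the recursion `V_{wi} φ = V_i (V_w φ)`:
for the word `w = [w₁, …, w_m]` it is built up letter by letter from the left. -/
noncomputable def iterOp {N d : ℕ} (V : Fin d → (Fin N → ℝ) → (Fin N → ℝ))
    (w : List (Fin d)) (φ : (Fin N → ℝ) → ℝ) : (Fin N → ℝ) → ℝ :=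
  w.foldl (fun ψ i => vfOp V i ψ) φ

/-- Partial derivative `∂f/∂x_j` of a scalar function on `ℝ^N`. -/
noncomputable def pd {N : ℕ} (j : Fin N) (f : (Fin N → ℝ) → ℝ) : (Fin N → ℝ) → ℝ :=
  fun x => fderiv ℝ f x (Pi.single j 1)

/-- Iterated (mixed) partial derivative in the listed directions, first entry applied first. -/
noncomputable def pdList {N : ℕ} : List (Fin N) → ((Fin N → ℝ) → ℝ) → (Fin N → ℝ) → ℝ
  | [], f => f
  | j :: js, f => pdList js (pd j f)

/-- A letter-labelled recursive tree `τ⁰ ∈ 𝕋_w⁰` of order `m+1`, with root vertex `0` and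
non-root vertices `1, …, m` (vertex `k+1` carrying the letter `w (k+1)`), is encoded by its
structure tuple `par`, where the `k`-th edge attaches vertex `k+1` to the earlier vertex
`par k ∈ {0, …, k}`.  The associated tree-like operator `V_{τ⁰}` is expanded in coordinates:
a choice of directions `j : Fin m → Fin N` assigns direction `j k` to edge `k`; the root
contributes the mixed partial of `φ` in the directions of its outgoing edges, while vertex `k+1`
contributes the mixed partials (in the directions of its outgoing edges) of the coordinate
projection `π_{j k} (V_{w (k+1)})` of its tree-like vector field factor. -/
noncomputable def treeOp {N d m : ℕ} (V : Fin d → (Fin N → ℝ) → (Fin N → ℝ))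
    (w : Fin m → Fin d) (par : ∀ k : Fin m, Fin (k.val + 1))
    (φ : (Fin N → ℝ) → ℝ) (x : Fin N → ℝ) : ℝ :=
  ∑ j : Fin m → Fin N,
    pdList (((List.finRange m).filter (fun k => decide ((par k : ℕ) = 0))).map j) φ x
      * ∏ v : Fin m,
          pdList (((List.finRange m).filter (fun k => decide ((par k : ℕ) = v.val + 1))).map j)
            (fun y => V (w v) y (j v)) x

theorem contDiff_pd {N : ℕ} (j : Fin N) {f : (Fin N → ℝ) → ℝ} (hf : ContDiff ℝ (⊤ : ℕ∞) f) :
    ContDiff ℝ (⊤ : ℕ∞) (pd j f) :=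
  (hf.fderiv_right (m := ((⊤ : ℕ∞) : WithTop ℕ∞)) (by simp)).clm_apply contDiff_const

theorem contDiff_pdList {N : ℕ} (l : List (Fin N)) {f : (Fin N → ℝ) → ℝ}
    (hf : ContDiff ℝ (⊤ : ℕ∞) f) : ContDiff ℝ (⊤ : ℕ∞) (pdList l f) := by
  induction l generalizing f with
  | nil => exact hf
  | cons j l ih => exact ih (contDiff_pd j hf)

theorem pdList_append_singleton {N : ℕ} (l : List (Fin N)) (a : Fin N) (f : (Fin N → ℝ) → ℝ) :
    pdList (l ++ [a]) f = pd a (pdList l f) := by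
  induction l generalizing f with
  | nil => rfl
  | cons j l ih => exact ih (pd j f)

theorem vfOp_eq_sum {N d : ℕ} (V : Fin d → (Fin N → ℝ) → (Fin N → ℝ)) (i : Fin d)
    (f : (Fin N → ℝ) → ℝ) (x : Fin N → ℝ) :
    vfOp V i f x = ∑ l, V i x l * pd l f x := by
  unfold vfOp pd
  conv_lhs => rw [pi_eq_sum_univ' (V i x)]
  simp only [map_sum, map_smul, smul_eq_mul]

theorem pd_sum {N : ℕ} {ι : Type*} (s : Finset ι) (l : Fin N) {F : ι → (Fin N → ℝ) → ℝ}
    (hF : ∀ i, ContDiff ℝ (⊤ : ℕ∞) (F i)) (x : Fin N → ℝ) :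
    pd l (fun y => ∑ i ∈ s, F i y) x = ∑ i ∈ s, pd l (F i) x := by
  unfold pd
  rw [fderiv_fun_sum fun i _ => ((hF i).differentiable (by simp)).differentiableAt]
  simp

/-- The Leibniz rule for a partial derivative of a finite product. -/
theorem pd_prod {N : ℕ} {ι : Type*} [Fintype ι] [DecidableEq ι] (l : Fin N)
    {F : ι → (Fin N → ℝ) → ℝ} (hF : ∀ i, ContDiff ℝ (⊤ : ℕ∞) (F i)) (x : Fin N → ℝ) :
    pd l (fun y => ∏ i, F i y) x = ∑ p, ∏ i, if p = i then pd l (F i) x else F i x := by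
  unfold pd
  rw [fderiv_finsetProd fun i _ => ((hF i).differentiable (by simp)).differentiableAt]
  simp only [FunLike.coe_sum, Finset.sum_apply, FunLike.coe_smul, Pi.smul_apply, smul_eq_mul]
  refine Finset.sum_congr rfl fun p _ => ?_
  rw [← Finset.prod_erase_mul _ _ (Finset.mem_univ p), if_pos rfl]
  congr 1
  exact Finset.prod_congr rfl fun i hi => (if_neg (Finset.ne_of_mem_erase hi).symm).symm

/-- The edges leaving the vertex `u` of the recursive tree encoded by `par`. -/
def outEdges {m : ℕ} (par : ∀ k : Fin m, Fin (k.val + 1)) (u : ℕ) : List (Fin m) :=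
  (List.finRange m).filter fun k => decide ((par k : ℕ) = u)

/-- The factor contributed by the vertex `u` to a tree-like operator, for the directions `j`. -/
noncomputable def vertexFactor {N d m : ℕ} (V : Fin d → (Fin N → ℝ) → (Fin N → ℝ))
    (w : Fin m → Fin d) (φ : (Fin N → ℝ) → ℝ) (par : ∀ k : Fin m, Fin (k.val + 1))
    (j : Fin m → Fin N) (u : Fin (m + 1)) : (Fin N → ℝ) → ℝ :=
  pdList ((outEdges par u).map j)
    (Fin.cases (motive := fun _ => (Fin N → ℝ) → ℝ) φ (fun v y => V (w v) y (j v)) u)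

theorem treeOp_eq_sum_prod {N d m : ℕ} (V : Fin d → (Fin N → ℝ) → (Fin N → ℝ))
    (w : Fin m → Fin d) (par : ∀ k : Fin m, Fin (k.val + 1)) (φ : (Fin N → ℝ) → ℝ)
    (x : Fin N → ℝ) :
    treeOp V w par φ x = ∑ j : Fin m → Fin N, ∏ u, vertexFactor V w φ par j u x := by
  simp only [Fin.prod_univ_succ]
  rfl

theorem contDiff_vertexFactor {N d m : ℕ} {V : Fin d → (Fin N → ℝ) → (Fin N → ℝ)}
    (hV : ∀ i, ContDiff ℝ (⊤ : ℕ∞) (V i)) (w : Fin m → Fin d) {φ : (Fin N → ℝ) → ℝ}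
    (hφ : ContDiff ℝ (⊤ : ℕ∞) φ) (par : ∀ k : Fin m, Fin (k.val + 1))
    (j : Fin m → Fin N) (u : Fin (m + 1)) :
    ContDiff ℝ (⊤ : ℕ∞) (vertexFactor V w φ par j u) := by
  refine contDiff_pdList _ ?_
  cases u using Fin.cases with
  | zero => exact hφ
  | succ v => exact contDiff_pi.1 (hV (w v)) (j v)

/-- Appending the vertex `m + 1` as a child of `p` to a recursive tree on `{0, …, m}`. -/
def appendVertex {m : ℕ} (par : ∀ k : Fin m, Fin (k.val + 1)) (p : Fin (m + 1)) :
    ∀ k : Fin (m + 1), Fin (k.val + 1) :=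
  Fin.snoc (α := fun k : Fin (m + 1) => Fin (k.val + 1)) par p

theorem outEdges_appendVertex {m : ℕ} (par : ∀ k : Fin m, Fin (k.val + 1)) (p : Fin (m + 1))
    (u : ℕ) :
    outEdges (appendVertex par p) u =
      (outEdges par u).map Fin.castSucc ++ if (p : ℕ) = u then [Fin.last m] else [] := by
  have hc (k : Fin m) : (appendVertex par p k.castSucc : ℕ) = par k :=
    congrArg Fin.val (Fin.snoc_castSucc (α := fun k : Fin (m + 1) => Fin (k.val + 1)) p par k)
  have hl : (appendVertex par p (Fin.last m) : ℕ) = p :=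
    congrArg Fin.val (Fin.snoc_last (α := fun k : Fin (m + 1) => Fin (k.val + 1)) p par)
  simp [outEdges, List.finRange_succ_last, List.filter_append, List.filter_map,
    Function.comp_def, hc, hl, List.filter_singleton]

theorem outEdges_last {m : ℕ} (par : ∀ k : Fin m, Fin (k.val + 1)) :
    outEdges par m = [] := by
  simp only [outEdges, List.filter_eq_nil_iff, decide_eq_true_eq]
  intro k _
  have := (par k).isLt
  omega

theorem vertexFactor_castSucc {N d m : ℕ} (V : Fin d → (Fin N → ℝ) → (Fin N → ℝ))
    (w : Fin (m + 1) → Fin d) (φ : (Fin N → ℝ) → ℝ) (par : ∀ k : Fin m, Fin (k.val + 1))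
    (p : Fin (m + 1)) (j : Fin m → Fin N) (l : Fin N) (u : Fin (m + 1)) :
    vertexFactor V w φ (appendVertex par p) (Fin.snoc (α := fun _ => Fin N) j l) u.castSucc =
      if p = u then pd l (vertexFactor V (fun k => w k.castSucc) φ par j u)
      else vertexFactor V (fun k => w k.castSucc) φ par j u := by
  have hbase : (Fin.cases (motive := fun _ => (Fin N → ℝ) → ℝ) φ
      (fun v y => V (w v) y (Fin.snoc (α := fun _ => Fin N) j l v)) u.castSucc) =
      Fin.cases (motive := fun _ => (Fin N → ℝ) → ℝ) φ
        (fun v y => V (w v.castSucc) y (j v)) u := by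
    cases u using Fin.cases with
    | zero => rfl
    | succ v => simp
  unfold vertexFactor
  rw [hbase, outEdges_appendVertex, ← pdList_append_singleton]
  by_cases h : p = u <;> simp [h, Fin.val_inj, Function.comp_def]

theorem vertexFactor_last {N d m : ℕ} (V : Fin d → (Fin N → ℝ) → (Fin N → ℝ))
    (w : Fin (m + 1) → Fin d) (φ : (Fin N → ℝ) → ℝ) (par : ∀ k : Fin (m + 1), Fin (k.val + 1))
    (j : Fin m → Fin N) (l : Fin N) (x : Fin N → ℝ) :
    vertexFactor V w φ par (Fin.snoc (α := fun _ => Fin N) j l) (Fin.last (m + 1)) x =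
      V (w (Fin.last m)) x l := by
  unfold vertexFactor
  rw [Fin.val_last, outEdges_last]
  exact congrArg (V (w (Fin.last m)) x) (Fin.snoc_last (α := fun _ => Fin N) l j)

/-- Applying `V_i` to a tree-like operator attaches a new vertex labelled `i` to each vertex. -/
theorem vfOp_sum_treeOp {N d m : ℕ} {V : Fin d → (Fin N → ℝ) → (Fin N → ℝ)}
    (hV : ∀ i, ContDiff ℝ (⊤ : ℕ∞) (V i)) (w : Fin (m + 1) → Fin d) {φ : (Fin N → ℝ) → ℝ}
    (hφ : ContDiff ℝ (⊤ : ℕ∞) φ) (par : ∀ k : Fin m, Fin (k.val + 1)) (x : Fin N → ℝ) :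
    vfOp V (w (Fin.last m)) (treeOp V (fun k => w k.castSucc) par φ) x =
      ∑ p, treeOp V w (appendVertex par p) φ x := by
  have hF (j : Fin m → Fin N) (u : Fin (m + 1)) :
      ContDiff ℝ (⊤ : ℕ∞) (vertexFactor V (fun k => w k.castSucc) φ par j u) :=
    contDiff_vertexFactor hV _ hφ par j u
  have hsnoc (p : Fin (m + 1)) : treeOp V w (appendVertex par p) φ x =
      ∑ l, ∑ j : Fin m → Fin N, V (w (Fin.last m)) x l *
        ∏ u, if p = u then pd l (vertexFactor V (fun k => w k.castSucc) φ par j u) x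
          else vertexFactor V (fun k => w k.castSucc) φ par j u x := by
    rw [treeOp_eq_sum_prod, ← (Fin.snocEquiv fun _ => Fin N).sum_comp, Fintype.sum_prod_type]
    refine Finset.sum_congr rfl fun l _ => Finset.sum_congr rfl fun j _ => ?_
    rw [Fin.prod_univ_castSucc, mul_comm]
    change vertexFactor V w φ _ (Fin.snoc (α := fun _ => Fin N) j l) _ x *
      ∏ u : Fin (m + 1), vertexFactor V w φ _ (Fin.snoc (α := fun _ => Fin N) j l) _ x = _
    rw [vertexFactor_last]
    congr 1
    refine Finset.prod_congr rfl fun u _ => ?_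
    rw [vertexFactor_castSucc]
    split_ifs <;> rfl
  simp only [hsnoc, vfOp_eq_sum]
  rw [Finset.sum_comm]
  refine Finset.sum_congr rfl fun l _ => ?_
  rw [Finset.sum_comm, funext (treeOp_eq_sum_prod V (fun k => w k.castSucc) par φ),
    pd_sum _ _ fun j => contDiff_prod fun u _ => hF j u, Finset.mul_sum]
  refine Finset.sum_congr rfl fun j _ => ?_
  rw [pd_prod l (hF j), Finset.mul_sum]

theorem contDiff_treeOp {N d m : ℕ} {V : Fin d → (Fin N → ℝ) → (Fin N → ℝ)}
    (hV : ∀ i, ContDiff ℝ (⊤ : ℕ∞) (V i)) (w : Fin m → Fin d) {φ : (Fin N → ℝ) → ℝ}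
    (hφ : ContDiff ℝ (⊤ : ℕ∞) φ) (par : ∀ k : Fin m, Fin (k.val + 1)) :
    ContDiff ℝ (⊤ : ℕ∞) (treeOp V w par φ) := by
  rw [funext (treeOp_eq_sum_prod V w par φ)]
  exact ContDiff.sum fun j _ => contDiff_prod fun u _ => contDiff_vertexFactor hV w hφ par j u

/-- **Tree expansion of iterated vector-field operators** (Lemma 3.4 of the paper):
for every word `w ∈ 𝒲_m`, the iterated operator `V_w` equals the sum of the tree-like
operators `V_{τ⁰}` over all letter-labelled recursive trees `τ⁰ ∈ 𝕋_w⁰` of order `m+1`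
whose root is labelled `0` and whose remaining vertices carry the letters of `w`. -/
theorem iterated_operator_tree_expansion
    {d N : ℕ} (V : Fin d → (Fin N → ℝ) → (Fin N → ℝ))
    (hV : ∀ i, ContDiff ℝ (⊤ : ℕ∞) (V i))
    (m : ℕ) (w : Fin m → Fin d)
    (φ : (Fin N → ℝ) → ℝ) (hφ : ContDiff ℝ (⊤ : ℕ∞) φ) (x : Fin N → ℝ) :
    iterOp V (List.ofFn w) φ x = ∑ par : (∀ k : Fin m, Fin (k.val + 1)), treeOp V w par φ x := by
  induction m generalizing x with
  | zero =>
    simp [iterOp, treeOp, pdList]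
  | succ m ih =>
    have hiter : iterOp V (List.ofFn w) φ =
        vfOp V (w (Fin.last m)) (iterOp V (List.ofFn fun k : Fin m => w k.castSucc) φ) := by
      rw [iterOp, List.ofFn_succ_last, List.foldl_append]
      rfl
    rw [hiter, funext (ih fun k => w k.castSucc),
      ← (Fin.snocEquiv fun k : Fin (m + 1) => Fin (k.val + 1)).sum_comp, Fintype.sum_prod_type,
      Finset.sum_comm, vfOp_eq_sum]
    simp only [pd_sum _ _ (contDiff_treeOp hV (fun k => w k.castSucc) hφ), Finset.mul_sum]
    rw [Finset.sum_comm]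
    refine Finset.sum_congr rfl fun par _ => ?_
    rw [← vfOp_eq_sum, vfOp_sum_treeOp hV w hφ]
    rfl
end

section
/- Let V_1, V_2, V_3 : ℝ → ℝ be arbitrary smooth vector fields on ℝ (N = 1). Then the iterated operators on C^∞(ℝ) satisfy the nontrivial identity V_{123} + V_{231} + V_{312} = V_{132} + V_{213} + V_{321}; in particular the collection { V_w | w ∈ 𝒲_3 } of iterated operators for words of length 3 over the alphabet {1,2,3} is never linearly independent when N = 1 (Remark 3.6). -/
/-- In dimension `N = 1` the vector field `V i : ℝ → ℝ` acts on functions by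
`(V_i φ)(x) = φ'(x) V_i(x)`. -/
noncomputable def vfOp1 {d : ℕ} (V : Fin d → ℝ → ℝ) (i : Fin d) (φ : ℝ → ℝ) : ℝ → ℝ :=
  fun x => deriv φ x * V i x

/-- The iterated operator `V_w`, defined by the recursion `V_{wi} φ = V_i (V_w φ)`,
for words `w` represented as lists of letters. -/
noncomputable def iterOp1 {d : ℕ} (V : Fin d → ℝ → ℝ) (w : List (Fin d)) (φ : ℝ → ℝ) :
    ℝ → ℝ :=
  w.foldl (fun ψ i => vfOp1 V i ψ) φ

theorem iterOp1_length_three {d : ℕ} {V : Fin d → ℝ → ℝ}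
    (hV : ∀ i, ContDiff ℝ (⊤ : ℕ∞) (V i)) {φ : ℝ → ℝ} (hφ : ContDiff ℝ (⊤ : ℕ∞) φ)
    (i j k : Fin d) (x : ℝ) :
    iterOp1 V [i, j, k] φ x =
      (((deriv (deriv (deriv φ)) x * V i x + deriv (deriv φ) x * deriv (V i) x +
          (deriv (deriv φ) x * deriv (V i) x + deriv φ x * deriv (deriv (V i)) x)) * V j x +
        (deriv (deriv φ) x * V i x + deriv φ x * deriv (V i) x) * deriv (V j) x)) * V k x := by
  have hderiv {f : ℝ → ℝ} (hf : ContDiff ℝ (⊤ : ℕ∞) f) : ContDiff ℝ (⊤ : ℕ∞) (deriv f) :=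
    (contDiff_infty_iff_deriv.mp hf).2
  have hasDeriv {f : ℝ → ℝ} (hf : ContDiff ℝ (⊤ : ℕ∞) f) (y : ℝ) :
      HasDerivAt f (deriv f y) y :=
    ((contDiff_infty_iff_deriv.mp hf).1 y).hasDerivAt
  have first : deriv (fun y => deriv φ y * V i y) =
      fun y => deriv (deriv φ) y * V i y + deriv φ y * deriv (V i) y :=
    funext fun y => ((hasDeriv (hderiv hφ) y).mul (hasDeriv (hV i) y)).deriv
  simp only [iterOp1, List.foldl_cons, List.foldl_nil]
  unfold vfOp1
  rw [first]
  congr 1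
  have hφ₁ := hasDeriv (hderiv hφ) x
  have hφ₂ := hasDeriv (hderiv (hderiv hφ)) x
  have hVi := hasDeriv (hV i) x
  have hVi' := hasDeriv (hderiv (hV i)) x
  exact (((hφ₂.mul hVi).add (hφ₁.mul hVi')).mul (hasDeriv (hV j) x)).deriv

/-- **Remark 3.6 of the paper** (letters `1,2,3` are `0,1,2 : Fin 3`): for arbitrary smooth
vector fields `V₁, V₂, V₃ : ℝ → ℝ` one has the nontrivial operator identity
`V_{123} + V_{231} + V_{312} = V_{132} + V_{213} + V_{321}` on `C^∞(ℝ)`; in particular the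
collection `{V_w | w ∈ 𝒲₃}` of iterated operators for words of length 3 over the alphabet
`{1,2,3}` is never linearly independent in dimension `N = 1`. -/
theorem length_three_operators_never_linearly_independent_in_dimension_one
    (V : Fin 3 → ℝ → ℝ) (hV : ∀ i, ContDiff ℝ (⊤ : ℕ∞) (V i)) :
    (∀ φ : ℝ → ℝ, ContDiff ℝ (⊤ : ℕ∞) φ → ∀ x : ℝ,
      iterOp1 V [0, 1, 2] φ x + iterOp1 V [1, 2, 0] φ x + iterOp1 V [2, 0, 1] φ x
        = iterOp1 V [0, 2, 1] φ x + iterOp1 V [1, 0, 2] φ x + iterOp1 V [2, 1, 0] φ x)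
    ∧ ¬ (∀ c : (Fin 3 → Fin 3) → ℝ,
          (∀ φ : ℝ → ℝ, ContDiff ℝ (⊤ : ℕ∞) φ → ∀ x : ℝ,
            ∑ w : Fin 3 → Fin 3, c w * iterOp1 V (List.ofFn w) φ x = 0) → c = 0) := by
  have identity : ∀ φ : ℝ → ℝ, ContDiff ℝ (⊤ : ℕ∞) φ → ∀ x : ℝ,
      iterOp1 V [0, 1, 2] φ x + iterOp1 V [1, 2, 0] φ x + iterOp1 V [2, 0, 1] φ x
        = iterOp1 V [0, 2, 1] φ x + iterOp1 V [1, 0, 2] φ x + iterOp1 V [2, 1, 0] φ x := by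
    intro φ hφ x
    simp only [iterOp1_length_three hV hφ]
    ring
  refine ⟨identity, fun independent => ?_⟩
  let c : (Fin 3 → Fin 3) → ℝ :=
    Pi.single ![0, 1, 2] 1 + Pi.single ![1, 2, 0] 1 + Pi.single ![2, 0, 1] 1
      - Pi.single ![0, 2, 1] 1 - Pi.single ![1, 0, 2] 1 - Pi.single ![2, 1, 0] 1
  have hc : c = 0 := by
    refine independent c fun φ hφ x => ?_
    simp only [c, Pi.add_apply, Pi.sub_apply, add_mul, sub_mul, Finset.sum_add_distrib,
      Finset.sum_sub_distrib, Pi.single_apply, ite_mul, one_mul, zero_mul,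
      Finset.sum_ite_eq', Finset.mem_univ, if_true]
    have h := identity φ hφ x
    simp only [List.ofFn_succ, List.ofFn_zero, Matrix.cons_val_zero, Matrix.cons_val_succ]
    linarith
  have h := congrFun hc ![0, 1, 2]
  simp [c] at h
end

section
/- Let A_1,…,A_d ∈ ℝ^{N×N} with entries α_{jk}(i) and let D_1,…,D_d ∈ ℝ^{N×N} be diagonal with diagonal entries d_j(i), such that the family of all these entries is algebraically independent over ℚ, and define V_i(x) = exp(A_i exp(D_i x)) for i = 1,…,d, with exp applied entrywise. Then for every fixed m ≤ N + 1, the iterated differential operators { V_w : C^∞(ℝ^N) → C^∞(ℝ^N) | w ∈ 𝒲_m } are linearly independent (Section 3.3.2, conclusion). -/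
/-- The depth-two nested exponential vector field `V_i(x) = exp(A_i exp(D_i x))`, with `exp`
applied entrywise, `A_i = (α_{jk}(i))` and `D_i` diagonal with entries `dv_j(i)`. -/
noncomputable def nestedExpVF {N d : ℕ} (α : Fin d → Matrix (Fin N) (Fin N) ℝ)
    (dv : Fin d → Fin N → ℝ) (i : Fin d) : (Fin N → ℝ) → Fin N → ℝ :=
  fun x k => Real.exp (∑ l, α i k l * Real.exp (dv i l * x l))

open MvPolynomial

section Calculus

variable {σ E : Type*} [NormedAddCommGroup E] [NormedSpace ℝ E]

/-- The chain rule for polynomial expressions in differentiable functions. -/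
theorem exists_hasFDerivAt_eval (y : E → σ → ℝ) (x : E) (p : MvPolynomial σ ℝ)
    (y' : σ → E →L[ℝ] ℝ) (hy : ∀ s, HasFDerivAt (fun z => y z s) (y' s) x) :
    ∃ L : E →L[ℝ] ℝ, HasFDerivAt (fun z => eval (y z) p) L x ∧
      ∀ (v : E) (f : σ → MvPolynomial σ ℝ), (∀ s, y' s v = eval (y x) (f s)) →
        L v = eval (y x) (mkDerivation ℝ f p) := by
  induction p using MvPolynomial.induction_on with
  | C a => exact ⟨0, by simpa using hasFDerivAt_const a x, by simp⟩
  | add p q hp hq =>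
    obtain ⟨L, hL, hL'⟩ := hp
    obtain ⟨M, hM, hM'⟩ := hq
    refine ⟨L + M, by simpa using hL.fun_add hM, fun v f hf => ?_⟩
    simp [hL' v f hf, hM' v f hf]
  | mul_X p s hp =>
    obtain ⟨L, hL, hL'⟩ := hp
    refine ⟨_, by simpa using hL.fun_mul (hy s), fun v f hf => ?_⟩
    simp [hL' v f hf, hf s, mkDerivation_X]

theorem hasDerivAt_eval_mkDerivation (y : ℝ → σ → ℝ) (f : σ → MvPolynomial σ ℝ) (t : ℝ)
    (hy : ∀ s, HasDerivAt (fun u => y u s) (eval (y t) (f s)) t) (p : MvPolynomial σ ℝ) :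
    HasDerivAt (fun u => eval (y u) p) (eval (y t) (mkDerivation ℝ f p)) t := by
  obtain ⟨L, hL, hL'⟩ := exists_hasFDerivAt_eval y t p _ fun s => (hy s).hasFDerivAt
  have h := hL.hasDerivAt
  rwa [hL' 1 f (by simp)] at h

end Calculus

section ExponentialPolynomials

variable {S : Type*}

theorem coeff_mkDerivation_smul_X [Fintype S] {R : Type*} [CommRing R] (δ : S → R)
    (p : MvPolynomial S R) (m : S →₀ ℕ) :
    coeff m (mkDerivation R (fun s => C (δ s) * X s) p) = (∑ s, m s * δ s) * coeff m p := by
  classical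
  induction p using MvPolynomial.induction_on generalizing m with
  | C a =>
    by_cases h : m = 0
    · simp [h]
    · simp [coeff_C, Ne.symm h]
  | add p q hp hq => simp [hp, hq, mul_add]
  | mul_X p s hp =>
    have h : mkDerivation R (fun s => C (δ s) * X s) (p * X s)
        = C (δ s) * (p * X s) + mkDerivation R (fun s => C (δ s) * X s) p * X s := by
      rw [Derivation.leibniz, mkDerivation_X]
      simp only [smul_eq_mul]
      ring
    rw [h, coeff_add, coeff_C_mul, coeff_mul_X', coeff_mul_X']
    split_ifs with hs
    · obtain ⟨n, rfl⟩ : ∃ n, m = n + Finsupp.single s 1 :=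
        ⟨m - Finsupp.single s 1, by
          rw [tsub_add_cancel_of_le]
          simpa [Finsupp.single_le_iff, Nat.one_le_iff_ne_zero] using hs⟩
      simp only [add_tsub_cancel_right, hp, Finsupp.add_apply, Nat.cast_add, add_mul,
        Finset.sum_add_distrib]
      have : ∑ x, ((Finsupp.single s 1 x : ℕ) : R) * δ x = δ s := by
        simp [Finsupp.single_apply]
      rw [this]
      ring
    · simp

theorem totalDegree_mkDerivation_smul_X_le [Fintype S] {R : Type*} [CommRing R] (δ : S → R)
    (p : MvPolynomial S R) :
    (mkDerivation R (fun s => C (δ s) * X s) p).totalDegree ≤ p.totalDegree := by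
  refine totalDegree_le_of_support_subset fun m hm => ?_
  rw [mem_support_iff, coeff_mkDerivation_smul_X] at hm
  exact mem_support_iff.2 (right_ne_zero_of_mul hm)

/-- Two nonzero polynomials whose logarithmic derivatives, for a derivation that acts diagonally
on the variables, differ by a linear form: the linear form vanishes. -/
theorem linearForm_eq_zero_of_mkDerivation [Fintype S] (δ β : S → ℝ) {p q : MvPolynomial S ℝ}
    (hp : p ≠ 0) (hq : q ≠ 0)
    (h : p * mkDerivation ℝ (fun s => C (δ s) * X s) q
        - q * mkDerivation ℝ (fun s => C (δ s) * X s) p = (∑ s, C (β s) * X s) * (p * q)) :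
    β = 0 := by
  classical
  by_contra hβ
  obtain ⟨s, hs⟩ := Function.ne_iff.1 hβ
  set L : MvPolynomial S ℝ := ∑ s, C (β s) * X s with hL
  have hc : coeff (Finsupp.single s 1) L = β s := by
    simp [hL, coeff_sum, coeff_C_mul, coeff_X, Finsupp.single_left_inj]
  have hL0 : L ≠ 0 := by
    intro h0
    rw [h0] at hc
    exact hs (by simpa using hc.symm)
  have hdeg : 1 ≤ L.totalDegree := by
    have := le_totalDegree (p := L) (s := Finsupp.single s 1)
      (mem_support_iff.2 (by rw [hc]; exact hs))
    simpa using this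
  have h1 : (L * (p * q)).totalDegree = L.totalDegree + (p.totalDegree + q.totalDegree) := by
    rw [totalDegree_mul_of_isDomain hL0 (mul_ne_zero hp hq), totalDegree_mul_of_isDomain hp hq]
  have h2 := totalDegree_sub (p * mkDerivation ℝ (fun s => C (δ s) * X s) q)
    (q * mkDerivation ℝ (fun s => C (δ s) * X s) p)
  have h3 := totalDegree_mul p (mkDerivation ℝ (fun s => C (δ s) * X s) q)
  have h4 := totalDegree_mul q (mkDerivation ℝ (fun s => C (δ s) * X s) p)
  have h5 := totalDegree_mkDerivation_smul_X_le δ p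
  have h6 := totalDegree_mkDerivation_smul_X_le δ q
  rw [h, h1] at h2
  rcases le_max_iff.1 h2 with h2 | h2 <;> omega

theorem eq_zero_of_eval_exp_eq_zero [Fintype S] {δ : S → ℝ} (hδ : LinearIndependent ℚ δ)
    (p : MvPolynomial S ℝ) (hp : ∀ t : ℝ, eval (fun s => δ s * Real.exp (δ s * t)) p = 0) :
    p = 0 := by
  let χ : ℝ → (Multiplicative ℝ →* ℝ) := fun a =>
    { toFun := fun t => Real.exp (a * t.toAdd)
      map_one' := by simp
      map_mul' := fun u v => by simp [mul_add, Real.exp_add] }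
  let freq : (S →₀ ℕ) → ℝ := fun m => ∑ s, m s * δ s
  have hfreq : Function.Injective freq := by
    intro m n hmn
    have h0 : ∑ s, ((m s : ℚ) - n s) • δ s = 0 := by
      have : ∑ s, (m s : ℝ) * δ s = ∑ s, (n s : ℝ) * δ s := hmn
      simp only [Rat.smul_def, Rat.cast_sub, Rat.cast_natCast, sub_mul, Finset.sum_sub_distrib,
        this, sub_self]
    ext s
    have := Fintype.linearIndependent_iff.1 hδ _ h0 s
    exact_mod_cast sub_eq_zero.1 this
  have hχ : Function.Injective χ := by
    intro a b hab
    have := congrArg (fun f : Multiplicative ℝ →* ℝ => f (Multiplicative.ofAdd 1)) hab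
    simpa [χ] using this
  have hli : LinearIndependent ℝ fun m : S →₀ ℕ => (χ (freq m) : Multiplicative ℝ → ℝ) :=
    (linearIndependent_monoidHom (Multiplicative ℝ) ℝ).comp _ (hχ.comp hfreq)
  have hsum : ∑ m ∈ p.support, (coeff m p * ∏ s, δ s ^ m s) •
      (χ (freq m) : Multiplicative ℝ → ℝ) = 0 := by
    funext t
    have := hp t.toAdd
    rw [eval_eq'] at this
    rw [Finset.sum_apply, Pi.zero_apply, ← this]
    refine Finset.sum_congr rfl fun m _ => ?_
    have : (χ (freq m) : Multiplicative ℝ → ℝ) t = ∏ s, Real.exp (δ s * t.toAdd) ^ m s := by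
      change Real.exp ((∑ s, m s * δ s) * t.toAdd) = _
      rw [Finset.sum_mul, Real.exp_sum]
      refine Finset.prod_congr rfl fun s _ => ?_
      rw [← Real.exp_nat_mul, mul_assoc]
    rw [Pi.smul_apply, this, smul_eq_mul, mul_assoc, ← Finset.prod_mul_distrib]
    simp only [mul_pow]
  ext m
  by_contra hm
  have := linearIndependent_iff'.1 hli _ _ hsum m (mem_support_iff.2 hm)
  rcases mul_eq_zero.1 this with h | h
  · exact hm (by simpa using h)
  · obtain ⟨s, -, hs⟩ := Finset.prod_eq_zero_iff.1 h
    exact hδ.ne_zero s (eq_zero_of_pow_eq_zero hs)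

/-- Linear independence of nested exponentials over the ring of exponential polynomials. -/
theorem eq_zero_of_sum_eval_exp_mul_exp_eq_zero [Fintype S] {δ : S → ℝ}
    (hδ : LinearIndependent ℚ δ) {ι : Type*} (b : ι → S → ℝ) (hb : Function.Injective b)
    (T : Finset ι) (p : ι → MvPolynomial S ℝ)
    (hp : ∀ t : ℝ, ∑ n ∈ T, eval (fun s => δ s * Real.exp (δ s * t)) (p n) *
      Real.exp (∑ s, b n s * Real.exp (δ s * t)) = 0) :
    ∀ n ∈ T, p n = 0 := by
  classical
  induction T using Finset.induction_on generalizing p with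
  | empty => simp
  | insert n₀ T hn₀ ih =>
    set e : ℝ → S → ℝ := fun t s => δ s * Real.exp (δ s * t) with he
    set D := mkDerivation ℝ (fun s => C (δ s) * X s : S → MvPolynomial S ℝ) with hD
    set L : ι → MvPolynomial S ℝ := fun n => ∑ s, C (b n s) * X s with hL
    have hexp : ∀ s t, HasDerivAt (fun t => Real.exp (δ s * t)) (e t s) t := fun s t => by
      have := ((hasDerivAt_id t).const_mul (δ s)).exp
      simpa [he, mul_comm] using this
    have hder : ∀ t, ∑ n ∈ insert n₀ T, eval (e t) (D (p n) + L n * p n) *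
        Real.exp (∑ s, b n s * Real.exp (δ s * t)) = 0 := fun t => by
      have h1 : ∀ n ∈ insert n₀ T, HasDerivAt (fun t => eval (e t) (p n) *
          Real.exp (∑ s, b n s * Real.exp (δ s * t))) (eval (e t) (D (p n) + L n * p n) *
            Real.exp (∑ s, b n s * Real.exp (δ s * t))) t := fun n _ => by
        have hq := hasDerivAt_eval_mkDerivation e (fun s => C (δ s) * X s) t
          (fun s => by simpa [he] using (hexp s t).const_mul (δ s)) (p n)
        have hs := (HasDerivAt.fun_sum fun s (_ : s ∈ Finset.univ) =>
          (hexp s t).const_mul (b n s)).exp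
        refine (hq.mul hs).congr_deriv ?_
        simp only [hL, map_add, map_mul, map_sum, eval_C, eval_X]
        ring
      have h2 := HasDerivAt.fun_sum h1
      rw [funext hp] at h2
      exact h2.unique (hasDerivAt_const t 0)
    have hT : p n₀ ≠ 0 → ∀ n ∈ T, p n = 0 := fun h0 n hn => by
      have hq := ih (fun n => p n₀ * (D (p n) + L n * p n)
        - (D (p n₀) + L n₀ * p n₀) * p n) (fun t => ?_) n hn
      · by_contra hpn
        have hβ := linearForm_eq_zero_of_mkDerivation δ (b n₀ - b n) h0 hpn (by
          have : ∑ s, C ((b n₀ - b n) s) * X s = L n₀ - L n := by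
            simp [hL, sub_mul]
          rw [this]
          linear_combination hq)
        have : n₀ = n := hb (sub_eq_zero.1 hβ)
        exact hn₀ (this ▸ hn)
      · have h1 := hp t
        have h2 := hder t
        rw [Finset.sum_insert hn₀] at h1 h2
        have : ∀ n, eval (e t) (p n₀ * (D (p n) + L n * p n) - (D (p n₀) + L n₀ * p n₀) * p n) *
            Real.exp (∑ s, b n s * Real.exp (δ s * t))
            = eval (e t) (p n₀) * (eval (e t) (D (p n) + L n * p n) *
              Real.exp (∑ s, b n s * Real.exp (δ s * t)))
            - eval (e t) (D (p n₀) + L n₀ * p n₀) * (eval (e t) (p n) *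
              Real.exp (∑ s, b n s * Real.exp (δ s * t))) := fun n => by
          rw [map_sub, map_mul, map_mul]
          ring
        rw [Finset.sum_congr rfl fun n _ => this n, Finset.sum_sub_distrib, ← Finset.mul_sum,
          ← Finset.mul_sum]
        linear_combination eval (e t) (p n₀) * h2 - eval (e t) (D (p n₀) + L n₀ * p n₀) * h1
    by_cases h0 : p n₀ = 0
    · have := ih p fun t => by
        have := hp t
        rwa [Finset.sum_insert hn₀, h0, map_zero, zero_mul, zero_add] at this
      simpa [h0] using this
    · exfalso
      refine h0 (eq_zero_of_eval_exp_eq_zero hδ _ fun t => ?_)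
      have := hp t
      rw [Finset.sum_insert hn₀, Finset.sum_eq_zero (s := T) fun n hn => by simp [hT h0 n hn],
        add_zero] at this
      exact (mul_eq_zero.1 this).resolve_right (Real.exp_ne_zero _)

/-- Algebraic independence of the nested exponentials `exp (∑ s, a k s * exp (δ s * t))` together
with the exponentials `δ s * exp (δ s * t)`. -/
theorem eq_zero_of_eval_nested_exp_eq_zero [Fintype S] {δ : S → ℝ} (hδ : LinearIndependent ℚ δ)
    {K : Type*} [Fintype K] (a : K → S → ℝ)
    (ha : Function.Injective fun (n : K →₀ ℕ) (s : S) => ∑ k, n k * a k s)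
    (p : MvPolynomial (K ⊕ S) ℝ)
    (hp : ∀ t : ℝ, eval (Sum.elim (fun k => Real.exp (∑ s, a k s * Real.exp (δ s * t)))
      (fun s => δ s * Real.exp (δ s * t))) p = 0) :
    p = 0 := by
  have hiter : ∀ (x : K → ℝ) (e : S → ℝ) (p : MvPolynomial (K ⊕ S) ℝ),
      eval (Sum.elim x e) p = eval₂ (eval e) x (sumRingEquiv ℝ K S p) := fun x e p => by
    induction p using MvPolynomial.induction_on with
    | C a => simp
    | add p q hp hq => simp [hp, hq]
    | mul_X p s hp => cases s <;> simp [hp, eval₂_mul]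
  refine (sumRingEquiv ℝ K S).injective ?_
  rw [map_zero]
  ext1 n
  rw [coeff_zero]
  by_contra hn
  refine hn (eq_zero_of_sum_eval_exp_mul_exp_eq_zero hδ _ ha (sumRingEquiv ℝ K S p).support
    (fun n => coeff n (sumRingEquiv ℝ K S p)) (fun t => ?_) n (mem_support_iff.2 hn))
  rw [← hp t, hiter, eval₂_eq']
  refine Finset.sum_congr rfl fun n _ => ?_
  congr 1
  simp only [← Real.exp_nat_mul, ← Real.exp_sum, Finset.mul_sum, Finset.sum_mul]
  rw [Finset.sum_comm]
  simp only [mul_assoc]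

end ExponentialPolynomials

section WordPolynomials

variable {d N : ℕ} {R : Type*} [CommRing R]

/-- The derivation along the `i`-th vector field, on polynomials in the components `V_{jk}`
(`Sum.inl (j, k)`) and in the exponentials `d_l(j) exp (d_l(j) x_l)` (`Sum.inr (j, l)`), with
parameters `a`. -/
noncomputable def fieldDerivation (a : (Fin d × Fin N × Fin N) ⊕ (Fin d × Fin N) → R) (i : Fin d) :
    Derivation R (MvPolynomial ((Fin d × Fin N) ⊕ (Fin d × Fin N)) R)
      (MvPolynomial ((Fin d × Fin N) ⊕ (Fin d × Fin N)) R) :=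
  mkDerivation R (Sum.elim
    (fun v => ∑ l, C (a (.inl (v.1, v.2, l))) * X (.inl (i, l)) * X (.inr (v.1, l)) * X (.inl v))
    (fun e => C (a (.inr e)) * X (.inl (i, e.2)) * X (.inr e)))

theorem map_fieldDerivation {R' : Type*} [CommRing R'] (f : R →+* R')
    (a : (Fin d × Fin N × Fin N) ⊕ (Fin d × Fin N) → R) (i : Fin d)
    (p : MvPolynomial ((Fin d × Fin N) ⊕ (Fin d × Fin N)) R) :
    map f (fieldDerivation a i p) = fieldDerivation (f ∘ a) i (map f p) := by
  induction p using MvPolynomial.induction_on with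
  | C a => simp [fieldDerivation]
  | add p q hp hq => simp [hp, hq]
  | mul_X p s hp =>
    rw [Derivation.leibniz, map_mul, Derivation.leibniz, map_add, smul_eq_mul, smul_eq_mul,
      smul_eq_mul, smul_eq_mul, map_mul, map_mul, hp, map_X]
    congr 2
    cases s <;> simp [fieldDerivation, mkDerivation_X]

/-- The variables that may occur in `wordPoly (shiftParam d N) w q` outside the chain monomial. -/
def lowVars (d N q : ℕ) : Set ((Fin d × Fin N) ⊕ (Fin d × Fin N)) :=
  {s | Sum.elim (fun v : Fin d × Fin N => v.2.val < q)
    (fun e : Fin d × Fin N => 0 < e.2.val ∧ e.2.val < q) s}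

theorem lowVars_mono {q q' : ℕ} (h : q ≤ q') : lowVars d N q ⊆ lowVars d N q' := by
  rintro (v | e) hs
  · exact lt_of_lt_of_le (show v.2.val < q from hs) h
  · exact ⟨hs.1, lt_of_lt_of_le hs.2 h⟩

theorem X_inl_mem_supported (j : Fin d) {k : Fin N} {q : ℕ} (hk : k.val < q) :
    X (.inl (j, k)) ∈ supported ℚ (lowVars d N q) :=
  Algebra.subset_adjoin ⟨_, hk, rfl⟩

theorem X_inr_mem_supported (j : Fin d) {k : Fin N} {q : ℕ} (h0 : 0 < k.val) (hk : k.val < q) :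
    X (.inr (j, k)) ∈ supported ℚ (lowVars d N q) :=
  Algebra.subset_adjoin ⟨_, show _ ∧ _ from ⟨h0, hk⟩, rfl⟩

variable [NeZero N]

/-- The polynomial representing the iterated operator of the word `w 0, …, w q` applied to the
first coordinate function. -/
noncomputable def wordPoly (a : (Fin d × Fin N × Fin N) ⊕ (Fin d × Fin N) → R) (w : ℕ → Fin d) :
    ℕ → MvPolynomial ((Fin d × Fin N) ⊕ (Fin d × Fin N)) R
  | 0 => X (.inl (w 0, 0))
  | q + 1 => fieldDerivation a (w (q + 1)) (wordPoly a w q)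

theorem map_wordPoly {R' : Type*} [CommRing R'] (f : R →+* R')
    (a : (Fin d × Fin N × Fin N) ⊕ (Fin d × Fin N) → R) (w : ℕ → Fin d) (q : ℕ) :
    map f (wordPoly a w q) = wordPoly (f ∘ a) w q := by
  induction q with
  | zero => simp [wordPoly]
  | succ q ih => rw [wordPoly, wordPoly, map_fieldDerivation, ih]

/-- The exponent of the monomial contributed to `wordPoly` by the chain `0 → 1 → ⋯ → q` (modulo
`N`). -/
noncomputable def chainExponent (N : ℕ) [NeZero N] (w : ℕ → Fin d) :
    ℕ → ((Fin d × Fin N) ⊕ (Fin d × Fin N) →₀ ℕ)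
  | 0 => Finsupp.single (.inl (w 0, 0)) 1
  | q + 1 => chainExponent N w q + Finsupp.single (.inl (w (q + 1), Fin.ofNat N (q + 1))) 1
      + Finsupp.single (.inr (w q, Fin.ofNat N (q + 1))) 1

theorem chainExponent_inl (w : ℕ → Fin d) (q : ℕ) (j : Fin d) (k : Fin N) :
    chainExponent N w q (.inl (j, k))
      = ∑ p ∈ Finset.range (q + 1), if w p = j ∧ Fin.ofNat N p = k then 1 else 0 := by
  induction q with
  | zero => rw [zero_add, Finset.sum_range_one]; simp [chainExponent, Finsupp.single_apply]
  | succ q ih => rw [Finset.sum_range_succ, ← ih]; simp [chainExponent, Finsupp.single_apply]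

theorem chainExponent_inr (w : ℕ → Fin d) (q : ℕ) (j : Fin d) (k : Fin N) :
    chainExponent N w q (.inr (j, k))
      = ∑ p ∈ Finset.range q, if w p = j ∧ Fin.ofNat N (p + 1) = k then 1 else 0 := by
  induction q with
  | zero => simp [chainExponent]
  | succ q ih => rw [Finset.sum_range_succ, ← ih]; simp [chainExponent, Finsupp.single_apply]

theorem Fin.ofNat_succ_eq_add_one (q : ℕ) : Fin.ofNat N (q + 1) = Fin.ofNat N q + 1 := by
  ext
  simp [Fin.val_add]

theorem Fin.ofNat_succ_inj_of_lt {p p' : ℕ} (hp : p < N) (hp' : p' < N)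
    (h : Fin.ofNat N (p + 1) = Fin.ofNat N (p' + 1)) : p = p' := by
  have h1 : (Fin.ofNat N (p + 1)).val = (Fin.ofNat N (p' + 1)).val := by rw [h]
  rw [Fin.val_ofNat, Fin.val_ofNat] at h1
  have h2 : p ≡ p' [MOD N] := Nat.ModEq.add_right_cancel' 1 h1
  exact Nat.ModEq.eq_of_lt_of_lt h2 hp hp'

theorem chainExponent_injective {w w' : ℕ → Fin d} {n : ℕ} (hn : n ≤ N)
    (h : chainExponent N w n = chainExponent N w' n) : ∀ p ≤ n, w p = w' p := by
  have hval : ∀ (u : ℕ → Fin d) (j : Fin d) (p : ℕ), p < n →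
      chainExponent N u n (.inr (j, Fin.ofNat N (p + 1))) = if u p = j then 1 else 0 := by
    intro u j p hp
    rw [chainExponent_inr, Finset.sum_eq_single p]
    · simp
    · intro p' hp' hne
      rw [if_neg]
      rintro ⟨-, h⟩
      exact hne (Fin.ofNat_succ_inj_of_lt ((Finset.mem_range.1 hp').trans_le hn) (hp.trans_le hn) h)
    · intro hp'
      exact absurd (Finset.mem_range.2 hp) hp'
  have hlt : ∀ p < n, w p = w' p := fun p hp => by
    have h1 := hval w (w p) p hp
    rw [h, hval w' (w p) p hp, if_pos rfl] at h1
    by_contra hne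
    rw [if_neg (Ne.symm hne)] at h1
    exact zero_ne_one h1
  have hlast : w n = w' n := by
    have h1 := chainExponent_inl w n (w n) (Fin.ofNat N n)
    rw [h, chainExponent_inl, Finset.sum_range_succ, Finset.sum_range_succ,
      Finset.sum_congr rfl fun p hp => by rw [← hlt p (Finset.mem_range.1 hp)]] at h1
    have h2 := Nat.add_left_cancel h1
    by_contra hne
    simp [Ne.symm hne] at h2
  intro p hp
  rcases hp.lt_or_eq with hp | rfl
  · exact hlt p hp
  · exact hlast

/-- The parameters for which the matrices `A_i` are the cyclic shift and `D_i = 0`. -/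
def shiftParam (d N : ℕ) [NeZero N] : (Fin d × Fin N × Fin N) ⊕ (Fin d × Fin N) → ℚ :=
  Sum.elim (fun p => if p.2.2 = p.2.1 + 1 then 1 else 0) (fun _ => 0)

theorem fieldDerivation_shiftParam_inl (i j : Fin d) (k : Fin N) :
    fieldDerivation (shiftParam d N) i (X (.inl (j, k)))
      = X (.inl (i, k + 1)) * X (.inr (j, k + 1)) * X (.inl (j, k)) := by
  simp [fieldDerivation, mkDerivation_X, shiftParam]

theorem fieldDerivation_shiftParam_inr (i : Fin d) (e : Fin d × Fin N) :
    fieldDerivation (shiftParam d N) i (X (.inr e)) = 0 := by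
  simp [fieldDerivation, mkDerivation_X, shiftParam]

theorem fieldDerivation_mem_supported (i : Fin d) {q : ℕ} (hq : q < N)
    {p : MvPolynomial ((Fin d × Fin N) ⊕ (Fin d × Fin N)) ℚ}
    (hp : p ∈ supported ℚ (lowVars d N q)) :
    fieldDerivation (shiftParam d N) i p ∈ supported ℚ (lowVars d N (q + 1)) := by
  have hmono := supported_mono (R := ℚ) (lowVars_mono (d := d) (N := N) (Nat.le_succ q))
  induction hp using Algebra.adjoin_induction with
  | mem x hx =>
    obtain ⟨s | e, hs, rfl⟩ := hx
    · obtain ⟨j, k⟩ := s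
      replace hs : k.val < q := hs
      have hk : (k + 1).val = k.val + 1 := Fin.val_add_one_of_lt' (by omega)
      rw [fieldDerivation_shiftParam_inl]
      exact mul_mem (mul_mem (X_inl_mem_supported _ (by omega))
        (X_inr_mem_supported _ (by omega) (by omega))) (X_inl_mem_supported _ (by omega))
    · rw [fieldDerivation_shiftParam_inr]
      exact zero_mem _
  | algebraMap r => simp
  | add x y _ _ hx hy => rw [map_add]; exact add_mem hx hy
  | mul x y hx' hy' hx hy =>
    rw [Derivation.leibniz]
    exact add_mem (mul_mem (hmono hx') hy) (mul_mem (hmono hy') hx)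

theorem monomial_chainExponent_succ (w : ℕ → Fin d) (q : ℕ) :
    (monomial (chainExponent N w (q + 1)) 1 : MvPolynomial _ ℚ)
      = monomial (chainExponent N w q) 1 * X (.inl (w (q + 1), Fin.ofNat N (q + 1)))
        * X (.inr (w q, Fin.ofNat N (q + 1))) := by
  simp [chainExponent, X, monomial_mul]

theorem monomial_chainExponent_mem_supported (w : ℕ → Fin d) {q : ℕ} (hq : q < N) :
    monomial (chainExponent N w q) 1 ∈ supported ℚ (lowVars d N (q + 1)) := by
  induction q with
  | zero => exact X_inl_mem_supported _ (by simp)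
  | succ q ih =>
    have hv : (Fin.ofNat N (q + 1)).val = q + 1 := by
      rw [Fin.val_ofNat, Nat.mod_eq_of_lt hq]
    rw [monomial_chainExponent_succ]
    exact mul_mem (mul_mem (supported_mono (lowVars_mono (Nat.le_succ _)) (ih (by omega)))
      (X_inl_mem_supported _ (by omega))) (X_inr_mem_supported _ (by omega) (by omega))

theorem fieldDerivation_monomial_chainExponent (w : ℕ → Fin d) (i : Fin d) {q : ℕ} (hq : q < N) :
    ∃ r ∈ supported ℚ (lowVars d N (q + 1)),
      fieldDerivation (shiftParam d N) i (monomial (chainExponent N w q) 1)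
        = monomial (chainExponent N w q) 1 * X (.inl (i, Fin.ofNat N (q + 1)))
          * X (.inr (w q, Fin.ofNat N (q + 1))) + r := by
  induction q generalizing i with
  | zero =>
    refine ⟨0, zero_mem _, ?_⟩
    change fieldDerivation (shiftParam d N) i (X (.inl (w 0, 0))) = X (.inl (w 0, 0)) * _ * _ + 0
    rw [fieldDerivation_shiftParam_inl]
    rw [show Fin.ofNat N (0 + 1) = 0 + 1 from Fin.ofNat_succ_eq_add_one 0]
    ring
  | succ q ih =>
    obtain ⟨r, hr, h⟩ := ih i (by omega)
    have hv : (Fin.ofNat N (q + 1)).val = q + 1 := by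
      rw [Fin.val_ofNat, Nat.mod_eq_of_lt hq]
    have hmono := supported_mono (R := ℚ) (lowVars_mono (d := d) (N := N) (Nat.le_succ (q + 1)))
    have hX : ∀ j : Fin d, X (.inl (j, Fin.ofNat N (q + 1)))
        ∈ supported ℚ (lowVars d N (q + 1 + 1)) := fun j => X_inl_mem_supported _ (by omega)
    have hE : ∀ j : Fin d, X (.inr (j, Fin.ofNat N (q + 1)))
        ∈ supported ℚ (lowVars d N (q + 1 + 1)) := fun j =>
      X_inr_mem_supported _ (by omega) (by omega)
    have hT := hmono (monomial_chainExponent_mem_supported w (show q < N by omega))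
    refine ⟨(monomial (chainExponent N w q) 1 * X (.inl (i, Fin.ofNat N (q + 1)))
          * X (.inr (w q, Fin.ofNat N (q + 1))) + r)
        * X (.inl (w (q + 1), Fin.ofNat N (q + 1))) * X (.inr (w q, Fin.ofNat N (q + 1))),
      ?_, ?_⟩
    · refine mul_mem (mul_mem (add_mem ?_ (hmono hr)) (hX _)) (hE _)
      exact mul_mem (mul_mem hT (hX i)) (hE _)
    have hcast : Fin.ofNat N (q + 1 + 1) = Fin.ofNat N (q + 1) + 1 :=
      Fin.ofNat_succ_eq_add_one _
    rw [monomial_chainExponent_succ, Derivation.leibniz, Derivation.leibniz,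
      fieldDerivation_shiftParam_inr, fieldDerivation_shiftParam_inl, h, hcast]
    simp only [smul_eq_mul]
    ring

/-- At the shift parameters, `wordPoly` is the chain monomial plus terms in lower variables. -/
theorem exists_wordPoly_shiftParam_eq (w : ℕ → Fin d) {q : ℕ} (hq : q ≤ N) :
    ∃ r ∈ supported ℚ (lowVars d N q),
      wordPoly (shiftParam d N) w q = monomial (chainExponent N w q) 1 + r := by
  induction q with
  | zero => exact ⟨0, zero_mem _, by simp [wordPoly, chainExponent, X]⟩
  | succ q ih =>
    obtain ⟨r, hr, h⟩ := ih (by omega)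
    obtain ⟨r', hr', h'⟩ := fieldDerivation_monomial_chainExponent w (w (q + 1)) (show q < N from hq)
    refine ⟨_, add_mem hr' (fieldDerivation_mem_supported (w (q + 1)) hq hr), ?_⟩
    rw [wordPoly, h, map_add, h', monomial_chainExponent_succ, add_assoc]

theorem coeff_chainExponent_eq_zero (w : ℕ → Fin d) {q : ℕ} (hq : q ≤ N)
    {r : MvPolynomial ((Fin d × Fin N) ⊕ (Fin d × Fin N)) ℚ}
    (hr : r ∈ supported ℚ (lowVars d N q)) : coeff (chainExponent N w q) r = 0 := by
  by_contra hne
  have hvars : ∀ s, chainExponent N w q s ≠ 0 → s ∈ lowVars d N q := fun s hs =>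
    mem_supported.1 hr (mem_vars_iff_mem_support _ |>.2
      ⟨_, mem_support_iff.2 hne, Finsupp.mem_support_iff.2 hs⟩)
  cases q with
  | zero =>
    have := hvars (.inl (w 0, 0)) (by simp [chainExponent])
    exact absurd (show (0 : Fin N).val < 0 from this) (by simp)
  | succ q =>
    have := hvars (.inr (w q, Fin.ofNat N (q + 1))) (by simp [chainExponent])
    have h : 0 < (Fin.ofNat N (q + 1)).val ∧ (Fin.ofNat N (q + 1)).val < q + 1 := this
    rw [Fin.val_ofNat] at h
    rcases hq.lt_or_eq with hq | hq
    · rw [Nat.mod_eq_of_lt hq] at h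
      omega
    · rw [hq, Nat.mod_self] at h
      omega

theorem coeff_wordPoly_shiftParam (w w' : ℕ → Fin d) {q : ℕ} (hq : q ≤ N) :
    coeff (chainExponent N w q) (wordPoly (shiftParam d N) w' q)
      = if chainExponent N w' q = chainExponent N w q then 1 else 0 := by
  classical
  obtain ⟨r, hr, h⟩ := exists_wordPoly_shiftParam_eq w' hq
  rw [h, coeff_add, coeff_chainExponent_eq_zero w hq hr, coeff_monomial, add_zero]

/-- For algebraically independent parameters, the polynomials of words of equal length are
linearly independent. -/
theorem eq_zero_of_sum_C_mul_wordPoly_eq_zero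
    {a : (Fin d × Fin N × Fin N) ⊕ (Fin d × Fin N) → ℝ} (ha : AlgebraicIndependent ℚ a)
    {n : ℕ} (hn : n ≤ N) {W : Type*} [Fintype W] (word : W → ℕ → Fin d)
    (hword : ∀ u v, (∀ p ≤ n, word u p = word v p) → u = v) (c : W → ℝ)
    (hc : ∑ v, C (c v) * wordPoly a (word v) n = 0) : c = 0 := by
  classical
  let M : Matrix W W (MvPolynomial ((Fin d × Fin N × Fin N) ⊕ (Fin d × Fin N)) ℚ) :=
    fun u v => coeff (chainExponent N (word u) n) (wordPoly X (word v) n)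
  have hM : ∀ {A : Type} [CommRing A] [Algebra ℚ A]
      (b : (Fin d × Fin N × Fin N) ⊕ (Fin d × Fin N) → A) (u v : W),
      aeval b (M u v) = coeff (chainExponent N (word u) n) (wordPoly b (word v) n) := by
    intro A _ _ b u v
    have h := map_wordPoly (aeval b : _ →ₐ[ℚ] A).toRingHom X (word v) n
    have hb : (aeval b : _ →ₐ[ℚ] A).toRingHom ∘ X = b := by
      funext s
      simp
    rw [hb] at h
    rw [← h, coeff_map]
    rfl
  have hspec : (aeval (shiftParam d N) : _ →ₐ[ℚ] ℚ) M.det = 1 := by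
    rw [AlgHom.map_det, ← Matrix.det_one (n := W)]
    congr 1
    ext u v
    rw [AlgHom.mapMatrix_apply, Matrix.map_apply, hM, coeff_wordPoly_shiftParam _ _ hn,
      Matrix.one_apply]
    refine if_congr ⟨fun h => ?_, fun h => by rw [h]⟩ rfl rfl
    exact (hword _ _ (chainExponent_injective hn h)).symm
  have hdet : M.det ≠ 0 := by
    intro h
    rw [h, map_zero] at hspec
    exact zero_ne_one hspec
  refine Matrix.eq_zero_of_mulVec_eq_zero (M := (aeval a : _ →ₐ[ℚ] ℝ).mapMatrix M) ?_ ?_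
  · rw [← AlgHom.map_det]
    intro h
    exact hdet ((algebraicIndependent_iff_injective_aeval.1 ha) (by rw [h, map_zero]))
  · funext u
    have := congrArg (coeff (chainExponent N (word u) n)) hc
    rw [coeff_sum, coeff_zero] at this
    rw [Pi.zero_apply, ← this, Matrix.mulVec, dotProduct]
    refine Finset.sum_congr rfl fun v _ => ?_
    rw [AlgHom.mapMatrix_apply, Matrix.map_apply, hM, coeff_C_mul, mul_comm]

end WordPolynomials

section NestedExponentials

variable {d N : ℕ} (α : Fin d → Matrix (Fin N) (Fin N) ℝ) (dv : Fin d → Fin N → ℝ)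

/-- The values at `x` of the variables of `wordPoly` for the nested exponential fields. -/
noncomputable def nestedExpVal (x : Fin N → ℝ) : (Fin d × Fin N) ⊕ (Fin d × Fin N) → ℝ :=
  Sum.elim (fun v => nestedExpVF α dv v.1 x v.2) (fun e => dv e.1 e.2 * Real.exp (dv e.1 e.2 * x e.2))

theorem vfOp_eval_nestedExpVal (i : Fin d)
    (p : MvPolynomial ((Fin d × Fin N) ⊕ (Fin d × Fin N)) ℝ) :
    vfOp (nestedExpVF α dv) i (fun x => eval (nestedExpVal α dv x) p)
      = fun x => eval (nestedExpVal α dv x) (fieldDerivation (Sum.elim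
          (fun q : Fin d × Fin N × Fin N => α q.1 q.2.1 q.2.2)
          (fun q : Fin d × Fin N => dv q.1 q.2)) i p) := by
  funext x
  have hexp : ∀ (j : Fin d) (l : Fin N), HasFDerivAt (fun z : Fin N → ℝ => Real.exp (dv j l * z l))
      (Real.exp (dv j l * x l) • dv j l •
        (ContinuousLinearMap.proj l : (Fin N → ℝ) →L[ℝ] ℝ)) x := fun j l =>
    ((hasFDerivAt_apply l x).const_mul (dv j l)).exp
  obtain ⟨L, hL, hL'⟩ := exists_hasFDerivAt_eval (nestedExpVal α dv) x p
    (Sum.elim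
      (fun v => nestedExpVF α dv v.1 x v.2 • ∑ l, α v.1 v.2 l • (Real.exp (dv v.1 l * x l) •
        dv v.1 l • (ContinuousLinearMap.proj l : (Fin N → ℝ) →L[ℝ] ℝ)))
      (fun e => dv e.1 e.2 • (Real.exp (dv e.1 e.2 * x e.2) • dv e.1 e.2 •
        (ContinuousLinearMap.proj e.2 : (Fin N → ℝ) →L[ℝ] ℝ)))) (by
      rintro (v | e)
      · exact (HasFDerivAt.fun_sum fun l _ => (hexp v.1 l).const_mul (α v.1 v.2 l)).exp
      · exact (hexp e.1 e.2).const_mul (dv e.1 e.2))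
  rw [vfOp, hL.fderiv]
  refine hL' _ _ ?_
  rintro (v | e)
  · simp only [Sum.elim_inl, map_sum, map_mul, eval_C, eval_X, nestedExpVal, Sum.elim_inr,
      _root_.smul_apply, _root_.sum_apply, ContinuousLinearMap.proj_apply,
      smul_eq_mul, Finset.mul_sum]
    refine Finset.sum_congr rfl fun l _ => ?_
    ring
  · simp only [Sum.elim_inl, map_mul, eval_C, eval_X, nestedExpVal, Sum.elim_inr,
      _root_.smul_apply, ContinuousLinearMap.proj_apply, smul_eq_mul]
    ring

theorem iterOp_ofFn_succ (V : Fin d → (Fin N → ℝ) → (Fin N → ℝ)) {q : ℕ} (w : Fin (q + 1) → Fin d)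
    (φ : (Fin N → ℝ) → ℝ) :
    iterOp V (List.ofFn w) φ
      = vfOp V (w (Fin.last q)) (iterOp V (List.ofFn fun p : Fin q => w p.castSucc) φ) := by
  rw [iterOp, iterOp, List.ofFn_succ', List.concat_eq_append, List.foldl_append]
  rfl

theorem iterOp_nestedExpVF_apply_coord [NeZero N] (w : ℕ → Fin d) (q : ℕ) :
    iterOp (nestedExpVF α dv) (List.ofFn fun p : Fin (q + 1) => w p) (fun x => x 0)
      = fun x => eval (nestedExpVal α dv x) (wordPoly (Sum.elim
          (fun q : Fin d × Fin N × Fin N => α q.1 q.2.1 q.2.2)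
          (fun q : Fin d × Fin N => dv q.1 q.2)) w q) := by
  induction q with
  | zero =>
    funext x
    rw [iterOp_ofFn_succ, vfOp]
    change fderiv ℝ (fun x : Fin N → ℝ => x 0) x _ = _
    rw [(hasFDerivAt_apply (0 : Fin N) x).fderiv]
    simp [wordPoly, nestedExpVal]
  | succ q ih =>
    rw [iterOp_ofFn_succ, wordPoly, ← vfOp_eval_nestedExpVal, ← ih]
    rfl

theorem eq_zero_of_eval_nestedExpVal_eq_zero [NeZero N]
    (halg : AlgebraicIndependent ℚ
      (Sum.elim (fun p : Fin d × Fin N × Fin N => α p.1 p.2.1 p.2.2)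
        (fun p : Fin d × Fin N => dv p.1 p.2)))
    (p : MvPolynomial ((Fin d × Fin N) ⊕ (Fin d × Fin N)) ℝ)
    (hp : ∀ x, eval (nestedExpVal α dv x) p = 0) : p = 0 := by
  have hli := halg.linearIndependent
  have hδ : LinearIndependent ℚ fun e : Fin d × Fin N => dv e.1 e.2 :=
    hli.comp Sum.inr Sum.inr_injective
  have hα : LinearIndependent ℚ fun q : Fin d × Fin N × Fin N => α q.1 q.2.1 q.2.2 :=
    hli.comp Sum.inl Sum.inl_injective
  refine eq_zero_of_eval_nested_exp_eq_zero hδ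
    (fun v e => if v.1 = e.1 then α v.1 v.2 e.2 else 0) ?_ p fun t => ?_
  · intro n n' h
    ext ⟨j, k⟩
    have h0 : ∑ k, (n (j, k) : ℝ) * α j k 0 = ∑ k, (n' (j, k) : ℝ) * α j k 0 := by
      simpa [Fintype.sum_prod_type_right] using congrFun h (j, 0)
    have hj : LinearIndependent ℚ fun k : Fin N => α j k 0 :=
      hα.comp (fun k => (j, k, 0)) fun k k' hk => by simpa using hk
    have h1 : ∑ k, ((n (j, k) : ℚ) - n' (j, k)) • α j k 0 = 0 := by
      simp only [Rat.smul_def, Rat.cast_sub, Rat.cast_natCast, sub_mul, Finset.sum_sub_distrib,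
        h0, sub_self]
    exact_mod_cast sub_eq_zero.1 (Fintype.linearIndependent_iff.1 hj _ h1 k)
  · refine Eq.trans ?_ (hp fun _ => t)
    congr 2
    funext s
    rcases s with v | e
    · simp [nestedExpVal, nestedExpVF, Fintype.sum_prod_type_right]
    · rfl

end NestedExponentials

/-- **Linear independence of iterated operators for depth-two nested exponentials**
(Section 3.3.2 of the paper): if all entries of `A₁, …, A_d` and of the diagonal matrices
`D₁, …, D_d` are algebraically independent over `ℚ`, then for every fixed `m ≤ N + 1` the
iterated differential operators `{ V_w : C^∞(ℝ^N) → C^∞(ℝ^N) | w ∈ 𝒲_m }` associated with the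
vector fields `V_i(x) = exp(A_i exp(D_i x))` are linearly independent. -/
theorem nested_exponential_iterated_operators_linearly_independent
    {d N : ℕ} (hd : 1 ≤ d) (hN : 1 ≤ N)
    (α : Fin d → Matrix (Fin N) (Fin N) ℝ) (dv : Fin d → Fin N → ℝ)
    (halg : AlgebraicIndependent ℚ
      (Sum.elim (fun p : Fin d × Fin N × Fin N => α p.1 p.2.1 p.2.2)
        (fun p : Fin d × Fin N => dv p.1 p.2)))
    (m : ℕ) (hm : m ≤ N + 1) :
    ∀ c : (Fin m → Fin d) → ℝ,
      (∀ φ : (Fin N → ℝ) → ℝ, ContDiff ℝ (⊤ : ℕ∞) φ → ∀ x,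
        ∑ w : Fin m → Fin d, c w * iterOp (nestedExpVF α dv) (List.ofFn w) φ x = 0) →
      c = 0 := by
  intro c hc
  have : NeZero N := ⟨by omega⟩
  cases m with
  | zero =>
    funext w
    have h := hc (fun _ => 1) contDiff_const 0
    simpa [iterOp, Subsingleton.elim w default] using h
  | succ n =>
    have hval : ∀ (w : Fin (n + 1) → Fin d) (p : Fin (n + 1)), w (Fin.ofNat (n + 1) p) = w p :=
      fun w p => by rw [Fin.ofNat_val_eq_self]
    refine eq_zero_of_sum_C_mul_wordPoly_eq_zero halg (n := n) (by omega)
      (fun (w : Fin (n + 1) → Fin d) (p : ℕ) => w (Fin.ofNat (n + 1) p)) (fun u v huv => ?_) c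
      (eq_zero_of_eval_nestedExpVal_eq_zero α dv halg _ fun x => ?_)
    · funext p
      rw [← hval u, ← hval v]
      exact huv p (Nat.lt_succ_iff.1 p.2)
    · rw [← hc (fun x => x 0) (contDiff_apply ℝ ℝ 0) x, map_sum]
      refine Finset.sum_congr rfl fun w _ => ?_
      have := congrFun (iterOp_nestedExpVF_apply_coord α dv (fun p : ℕ => w (Fin.ofNat (n + 1) p)) n) x
      simp only [hval] at this
      rw [map_mul, eval_C, this]
end

section
/- For r = 1,…,n let f_r : ℝ → ℝ be a function of the form f_r(x) = c_r x + Σ_{l=1}^{k_r} α_{r,l} e^{β_{r,l} x} with c_r, α_{r,l} ∈ ℝ, the β_{r,1},…,β_{r,k_r} pairwise distinct nonzero reals, and all α_{r,l} ≠ 0, and suppose the functions f_1,…,f_n are pairwise distinct. Then the functions exp(f_1),…,exp(f_n) : ℝ → ℝ are linearly independent over ℝ. -/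
/-- A 'linear plus exponential-polynomial' function
`f_r(x) = c_r x + Σ_{l=1}^{k_r} α_{r,l} e^{β_{r,l} x}`. -/
noncomputable def linExpPoly {n : ℕ} (k : Fin n → ℕ) (c : Fin n → ℝ)
    (α β : (r : Fin n) → Fin (k r) → ℝ) (r : Fin n) (x : ℝ) : ℝ :=
  c r * x + ∑ l, α r l * Real.exp (β r l * x)

/-- The exponential polynomial `x ↦ Σ_a p_a e^{a x}` attached to an element of the group algebra
`ℝ[ℝ]`, evaluated at `x`. -/
noncomputable def expEval (x : ℝ) : AddMonoidAlgebra ℝ ℝ →ₐ[ℝ] ℝ :=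
  AddMonoidAlgebra.lift ℝ ℝ ℝ
    { toFun := fun a => Real.exp (a.toAdd * x)
      map_one' := by simp
      map_mul' := fun a b => by simp [add_mul, Real.exp_add] }

theorem expEval_apply (x : ℝ) (p : AddMonoidAlgebra ℝ ℝ) :
    expEval x p = ∑ a ∈ p.coeff.support, p.coeff a * Real.exp (a * x) := by
  simp [expEval, AddMonoidAlgebra.lift_apply, Finsupp.sum]

theorem expEval_single (x a r : ℝ) :
    expEval x (AddMonoidAlgebra.single a r) = r * Real.exp (a * x) := by
  simp [expEval]

/-- The formal derivative `Σ_a p_a e^{a x} ↦ Σ_a a p_a e^{a x}`. -/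
noncomputable def expDeriv (p : AddMonoidAlgebra ℝ ℝ) : AddMonoidAlgebra ℝ ℝ :=
  ∑ a ∈ p.coeff.support, AddMonoidAlgebra.single a (a * p.coeff a)

theorem coeff_expDeriv (p : AddMonoidAlgebra ℝ ℝ) (a : ℝ) :
    (expDeriv p).coeff a = a * p.coeff a := by
  classical
  simp +contextual [expDeriv, AddMonoidAlgebra.coeff_sum, Finsupp.finsetSum_apply,
    Finsupp.single_apply]

theorem hasDerivAt_expEval (p : AddMonoidAlgebra ℝ ℝ) (x : ℝ) :
    HasDerivAt (fun y => expEval y p) (expEval x (expDeriv p)) x := by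
  rw [funext fun y => expEval_apply y p, expDeriv, map_sum]
  refine HasDerivAt.fun_sum fun a _ => ?_
  have h := ((hasDerivAt_const_mul (x := x) a).exp).const_mul (p.coeff a)
  rwa [show p.coeff a * (Real.exp (a * x) * a) = expEval x (.single a (a * p.coeff a)) by
    rw [expEval_single]; ring] at h

theorem eq_zero_of_expEval_eq_zero {p : AddMonoidAlgebra ℝ ℝ} (hp : ∀ x, expEval x p = 0) :
    p = 0 := by
  let χ : ℝ → (Multiplicative ℝ →* ℝ) := fun a =>
    { toFun := fun x => Real.exp (a * x.toAdd)
      map_one' := by simp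
      map_mul' := fun x y => by simp [mul_add, Real.exp_add] }
  have hχ : Function.Injective χ := fun a b hab => by
    simpa [χ] using DFunLike.congr_fun hab (Multiplicative.ofAdd 1)
  have hli := (linearIndependent_monoidHom (Multiplicative ℝ) ℝ).comp χ hχ
  rw [linearIndependent_iff'] at hli
  have h := hli p.coeff.support p.coeff (by
    ext x
    simpa [expEval_apply, χ] using hp x.toAdd)
  ext a
  by_contra ha
  exact ha (h a (by simpa using ha))

/-- `a` is an exponent of `p` maximising the linear functional `ε * ·`. -/
def IsLeadingExp (ε : ℝ) (p : AddMonoidAlgebra ℝ ℝ) (a : ℝ) : Prop :=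
  p.coeff a ≠ 0 ∧ ∀ b, p.coeff b ≠ 0 → ε * b ≤ ε * a

theorem exists_isLeadingExp (ε : ℝ) {p : AddMonoidAlgebra ℝ ℝ} (hp : p ≠ 0) :
    ∃ a, IsLeadingExp ε p a := by
  obtain ⟨a, ha, h⟩ := p.coeff.support.exists_max_image (fun b => ε * b)
    (by simpa [Finsupp.support_nonempty_iff] using hp)
  exact ⟨a, by simpa using ha, fun b hb => h b (by simpa using hb)⟩

theorem le_of_coeff_mul_ne_zero {ε a b c : ℝ} {p q : AddMonoidAlgebra ℝ ℝ}
    (hp : ∀ d, p.coeff d ≠ 0 → ε * d ≤ ε * a) (hq : ∀ d, q.coeff d ≠ 0 → ε * d ≤ ε * b)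
    (hc : (p * q).coeff c ≠ 0) : ε * c ≤ ε * (a + b) := by
  classical
  have hmem := AddMonoidAlgebra.support_coeff_mul_subset p q (Finsupp.mem_support_iff.2 hc)
  obtain ⟨d, hd, e, he, rfl⟩ := Finset.mem_add.1 hmem
  linarith [hp d (by simpa using hd), hq e (by simpa using he)]

theorem IsLeadingExp.mul {ε a b : ℝ} (hε : ε ≠ 0) {p q : AddMonoidAlgebra ℝ ℝ}
    (hp : IsLeadingExp ε p a) (hq : IsLeadingExp ε q b) : IsLeadingExp ε (p * q) (a + b) := by
  refine ⟨?_, fun c => le_of_coeff_mul_ne_zero hp.2 hq.2⟩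
  rw [AddMonoidAlgebra.coeff_mul_add_of_uniqueAdd]
  · exact mul_ne_zero hp.1 hq.1
  · intro d e hd he h
    have h1 := hp.2 d (by simpa using hd)
    have h2 := hq.2 e (by simpa using he)
    have h3 : ε * d + ε * e = ε * a + ε * b := by rw [← mul_add, h, mul_add]
    exact ⟨mul_left_cancel₀ hε (by linarith), mul_left_cancel₀ hε (by linarith)⟩

/-- A formal version of: if `e^h` is a quotient of exponential polynomials up to a constant, where
`h` is an exponential polynomial, then `h` is constant. -/
theorem eq_zero_of_logDeriv_eq {u v h : AddMonoidAlgebra ℝ ℝ} (hu : u ≠ 0) (h0 : h.coeff 0 = 0)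
    (hh : h ≠ 0) (H : u * expDeriv v - v * expDeriv u + u * v * expDeriv h = 0) : v = 0 := by
  by_contra hv
  obtain ⟨ε, hb⟩ : ∃ b, h.coeff b ≠ 0 := by
    by_contra! hall
    exact hh (AddMonoidAlgebra.ext (Finsupp.ext hall))
  have hε : ε ≠ 0 := by
    rintro rfl
    exact hb h0
  have hDε : (expDeriv h).coeff ε ≠ 0 := by
    rw [coeff_expDeriv]
    exact mul_ne_zero hε hb
  have hD : expDeriv h ≠ 0 := fun hz => hDε (by simp [hz])
  obtain ⟨a, ha⟩ := exists_isLeadingExp ε hu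
  obtain ⟨b, hb⟩ := exists_isLeadingExp ε hv
  obtain ⟨c, hc⟩ := exists_isLeadingExp ε hD
  have hpos : 0 < ε * c := (mul_self_pos.2 hε).trans_le (hc.2 ε hDε)
  have hsub {p : AddMonoidAlgebra ℝ ℝ} {e : ℝ} (hp : IsLeadingExp ε p e) (d : ℝ)
      (hd : (expDeriv p).coeff d ≠ 0) : ε * d ≤ ε * e := by
    rw [coeff_expDeriv] at hd
    exact hp.2 d (right_ne_zero_of_mul hd)
  have h1 : (u * expDeriv v).coeff (a + b + c) = 0 := by
    by_contra hne
    linarith [le_of_coeff_mul_ne_zero ha.2 (hsub hb) hne, mul_add ε (a + b) c]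
  have h2 : (v * expDeriv u).coeff (a + b + c) = 0 := by
    by_contra hne
    linarith [le_of_coeff_mul_ne_zero hb.2 (hsub ha) hne, mul_add ε (a + b) c, mul_add ε a b,
      mul_add ε b a]
  have h3 := congrArg (fun p => p.coeff (a + b + c)) H
  simp only [AddMonoidAlgebra.coeff_add, AddMonoidAlgebra.coeff_sub, Finsupp.add_apply,
    Finsupp.sub_apply, h1, h2, sub_zero, zero_add, AddMonoidAlgebra.coeff_zero,
    Finsupp.zero_apply] at h3
  exact ((ha.mul hε hb).mul hε hc).1 h3

/-- Exponentials of distinct exponential polynomials without constant term are linearly independent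
over the ring of exponential polynomials. -/
theorem expPoly_coeff_eq_zero (s : Finset (AddMonoidAlgebra ℝ ℝ)) :
    (∀ f ∈ s, f.coeff 0 = 0) → ∀ g : AddMonoidAlgebra ℝ ℝ → AddMonoidAlgebra ℝ ℝ,
      (∀ x, ∑ f ∈ s, expEval x (g f) * Real.exp (expEval x f) = 0) → ∀ f ∈ s, g f = 0 := by
  classical
  induction s using Finset.induction_on with
  | empty => simp
  | insert f₁ s hf₁ ih =>
    intro h0 g hg
    have h0s : ∀ f ∈ s, f.coeff 0 = 0 := fun f hf => h0 f (Finset.mem_insert_of_mem hf)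
    simp only [Finset.sum_insert hf₁] at hg
    have hs : g f₁ ≠ 0 → ∀ f ∈ s, g f = 0 := by
      intro hu
      have hcoeff := ih h0s (fun f => g f₁ * expDeriv (g f) - g f * expDeriv (g f₁)
        + g f₁ * g f * (expDeriv f - expDeriv f₁)) fun x => by
          have hterm (f : AddMonoidAlgebra ℝ ℝ) :=
            (hasDerivAt_expEval (g f) x).mul (hasDerivAt_expEval f x).exp
          have hsum := (hterm f₁).add (HasDerivAt.fun_sum fun f (_ : f ∈ s) => hterm f)
          have hzero := hsum.unique
            ((hasDerivAt_const x (0 : ℝ)).congr_of_eventuallyEq (.of_forall hg))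
          have hrel := hg x
          have key : ∀ f, expEval x (g f₁ * expDeriv (g f) - g f * expDeriv (g f₁)
              + g f₁ * g f * (expDeriv f - expDeriv f₁)) * Real.exp (expEval x f)
              = expEval x (g f₁) * (expEval x (expDeriv (g f)) * Real.exp (expEval x f)
                + expEval x (g f) * (Real.exp (expEval x f) * expEval x (expDeriv f)))
              - (expEval x (expDeriv (g f₁)) + expEval x (g f₁) * expEval x (expDeriv f₁))
                * (expEval x (g f) * Real.exp (expEval x f)) := fun f => by
            simp only [map_add, map_sub, map_mul]
            ring
          simp only [key, Finset.sum_sub_distrib, ← Finset.mul_sum]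
          linear_combination expEval x (g f₁) * hzero
            - (expEval x (expDeriv (g f₁)) + expEval x (g f₁) * expEval x (expDeriv f₁)) * hrel
      intro f hf
      refine eq_zero_of_logDeriv_eq (h := f - f₁) hu ?_ ?_ ?_
      · simp [h0s f hf, h0 f₁ (Finset.mem_insert_self _ _)]
      · rw [sub_ne_zero]
        rintro rfl
        exact hf₁ hf
      · have hD : expDeriv (f - f₁) = expDeriv f - expDeriv f₁ := by
          ext a
          simp [coeff_expDeriv, mul_sub]
        rw [hD]
        exact hcoeff f hf
    have hf₁0 : g f₁ = 0 := by
      by_contra hu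
      refine hu (eq_zero_of_expEval_eq_zero fun x => ?_)
      have hx := hg x
      rw [Finset.sum_eq_zero fun f hf => by simp [hs hu f hf], add_zero] at hx
      exact (mul_eq_zero.1 hx).resolve_right (Real.exp_ne_zero _)
    simp only [hf₁0, map_zero, zero_mul, zero_add] at hg
    exact Finset.forall_mem_insert _ _ _ |>.2 ⟨hf₁0, ih h0s g hg⟩

/-- **Linear independence of exponentials of 'linear plus exponential-polynomial' functions**
(used in Section 3.3.2 of the paper): if each `f_r(x) = c_r x + Σ_l α_{r,l} e^{β_{r,l} x}` has
pairwise distinct nonzero frequencies `β_{r,1}, …, β_{r,k_r}` and nonzero coefficients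
`α_{r,l}`, and the functions `f₁, …, fₙ` are pairwise distinct, then
`exp(f₁), …, exp(fₙ) : ℝ → ℝ` are linearly independent over `ℝ`. -/
theorem exp_of_linExpPoly_linearly_independent
    {n : ℕ} (k : Fin n → ℕ) (c : Fin n → ℝ) (α β : (r : Fin n) → Fin (k r) → ℝ)
    (hβinj : ∀ r, Function.Injective (β r))
    (hβne : ∀ r l, β r l ≠ 0)
    (hα : ∀ r l, α r l ≠ 0)
    (hdist : ∀ r s : Fin n, r ≠ s → linExpPoly k c α β r ≠ linExpPoly k c α β s) :
    ∀ γ : Fin n → ℝ,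
      (∀ x : ℝ, ∑ r, γ r * Real.exp (linExpPoly k c α β r x) = 0) → ∀ r, γ r = 0 := by
  classical
  intro γ hγ r
  let p : Fin n → AddMonoidAlgebra ℝ ℝ := fun r =>
    ∑ l, AddMonoidAlgebra.single (β r l) (α r l)
  have hp (r : Fin n) (x : ℝ) : linExpPoly k c α β r x = c r * x + expEval x (p r) := by
    simp [linExpPoly, p, expEval_single]
  let g : AddMonoidAlgebra ℝ ℝ → AddMonoidAlgebra ℝ ℝ := fun q =>
    ∑ r with p r = q, AddMonoidAlgebra.single (c r) (γ r)
  have hg := expPoly_coeff_eq_zero (Finset.univ.image p)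
    (by simp [p, AddMonoidAlgebra.coeff_sum, Finsupp.finsetSum_apply, hβne])
    g (fun x => by
      rw [← hγ x, ← Finset.sum_fiberwise_of_maps_to (t := Finset.univ.image p) (g := p)
        (by simp)]
      refine Finset.sum_congr rfl fun q _ => ?_
      simp only [g, map_sum, Finset.sum_mul]
      refine Finset.sum_congr rfl fun s hs => ?_
      rw [hp, expEval_single, Real.exp_add, (Finset.mem_filter.1 hs).2, mul_assoc])
    (p r) (by simp)
  have hr := congrArg (fun q => q.coeff (c r)) hg
  simp only [g, AddMonoidAlgebra.coeff_sum, Finsupp.finsetSum_apply, AddMonoidAlgebra.coeff_single,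
    AddMonoidAlgebra.coeff_zero, Finsupp.zero_apply] at hr
  rwa [Finset.sum_eq_single r, Finsupp.single_eq_same] at hr
  · intro s hs hsr
    refine Finsupp.single_eq_of_ne fun hc => hdist s r hsr (funext fun x => ?_)
    rw [hp, hp, (Finset.mem_filter.1 hs).2, hc]
  · simp
end
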